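/- arXiv:1903.08059 — 3 statements merged into one kernel-verified Lean document; each statement's English description precedes it below -/
import Mathlib

section
/- Let θ be a positive real number and let s and t be integers with 2 ≤ t ≤ s ≤ θ + 1. If G is a graph on n vertices such that k_t(G) ≥ C(θ,t)·(n/θ)^t, then k_s(G) ≥ C(θ,s)·(n/θ)^s. -/
open SimpleGraph

/-- Generalized binomial coefficient `C(x, m) = x(x-1)⋯(x-m+1)/m!` for real `x`. -/
noncomputable def genChoose (x : ℝ) (m : ℕ) : ℝ :=
  (∏ i ∈ Finset.range m, (x - i)) / (m.factorial : ℝ)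

/-- common neighbourhood -/
def cnb {n : ℕ} (G : SimpleGraph (Fin n)) [DecidableRel G.Adj] (D : Finset (Fin n)) :
    Finset (Fin n) := Finset.univ.filter (fun v => ∀ u ∈ D, G.Adj v u)

lemma double_count {n : ℕ} (G : SimpleGraph (Fin n)) [DecidableRel G.Adj] (m : ℕ)
    (f : Finset (Fin n) → ℕ) :
    ∑ C ∈ G.cliqueFinset (m + 1), ∑ v ∈ C, f (C.erase v) =
      ∑ D ∈ G.cliqueFinset m, (cnb G D).card * f D := by
  have h2 : ∀ D ∈ G.cliqueFinset m, (cnb G D).card * f D = ∑ v ∈ cnb G D, f D := by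
    intro D _
    simp
  rw [Finset.sum_congr rfl h2, Finset.sum_sigma', Finset.sum_sigma']
  refine Finset.sum_bij' (fun x _ => ⟨x.1.erase x.2, x.2⟩) (fun x _ => ⟨insert x.2 x.1, x.2⟩)
    ?_ ?_ ?_ ?_ ?_
  · rintro ⟨C, v⟩ h
    simp only [Finset.mem_sigma, mem_cliqueFinset_iff, cnb, Finset.mem_filter, Finset.mem_univ,
      true_and] at h ⊢
    obtain ⟨hC, hv⟩ := h
    refine ⟨⟨hC.isClique.subset (by simp), ?_⟩, ?_⟩
    · rw [Finset.card_erase_of_mem hv, hC.card_eq]; rfl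
    · intro u hu
      rw [Finset.mem_erase] at hu
      exact hC.isClique hv hu.2 hu.1.symm
  · rintro ⟨D, v⟩ h
    simp only [Finset.mem_sigma, mem_cliqueFinset_iff, cnb, Finset.mem_filter, Finset.mem_univ,
      true_and] at h ⊢
    exact ⟨h.1.insert h.2, Finset.mem_insert_self _ _⟩
  · rintro ⟨C, v⟩ h
    simp only [Finset.mem_sigma] at h
    simp [Finset.insert_erase h.2]
  · rintro ⟨D, v⟩ h
    simp only [Finset.mem_sigma, cnb, Finset.mem_filter] at h
    have : v ∉ D := fun hv => G.loopless.irrefl v (h.2.2 v hv)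
    simp [Finset.erase_insert this]
  · rintro ⟨C, v⟩ h
    rfl

lemma local_bound {n : ℕ} (G : SimpleGraph (Fin n)) [DecidableRel G.Adj] (m : ℕ)
    (C : Finset (Fin n)) (hC : C.card = m + 1) :
    ∑ u ∈ C, (cnb G (C.erase u)).card ≤ n + m * (cnb G C).card := by
  have h1 : ∑ u ∈ C, (cnb G (C.erase u)).card =
      ∑ v : Fin n, (C.filter (fun u => ∀ w ∈ C.erase u, G.Adj v w)).card := by
    simp only [cnb, Finset.card_filter]
    exact Finset.sum_comm
  have h2 : n + m * (cnb G C).card =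
      ∑ v : Fin n, (1 + m * (if ∀ u ∈ C, G.Adj v u then 1 else 0)) := by
    rw [Finset.sum_add_distrib, ← Finset.mul_sum]
    simp [cnb]
  rw [h1, h2]
  apply Finset.sum_le_sum
  intro v _
  split_ifs with hv
  · have := Finset.card_filter_le C (fun u => ∀ w ∈ C.erase u, G.Adj v w)
    omega
  · push Not at hv
    obtain ⟨w, hw, hvw⟩ := hv
    simp only [mul_zero, add_zero]
    rw [Finset.card_le_one]
    have key : ∀ a ∈ C.filter (fun u => ∀ w ∈ C.erase u, G.Adj v w), a = w := by
      intro a ha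
      rw [Finset.mem_filter] at ha
      by_contra hne
      exact hvw (ha.2 w (Finset.mem_erase.2 ⟨fun h => hne h.symm, hw⟩))
    intro a ha b hb
    rw [key a ha, key b hb]

lemma sum_cnb {n : ℕ} (G : SimpleGraph (Fin n)) [DecidableRel G.Adj] (m : ℕ) :
    ∑ D ∈ G.cliqueFinset m, (cnb G D).card = (m + 1) * (G.cliqueFinset (m + 1)).card := by
  have h := double_count G m (fun _ => 1)
  simp only [mul_one] at h
  rw [← h, mul_comm, ← smul_eq_mul, ← Finset.sum_const]
  apply Finset.sum_congr rfl
  intro C hC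
  rw [mem_cliqueFinset_iff] at hC
  simp [hC.card_eq]

lemma moon_moser {n : ℕ} (G : SimpleGraph (Fin n)) [DecidableRel G.Adj] (m : ℕ) :
    ((m + 1) * (G.cliqueFinset (m + 1)).card) ^ 2 ≤
      (G.cliqueFinset m).card * (n * (G.cliqueFinset (m + 1)).card +
        m * ((m + 2) * (G.cliqueFinset (m + 2)).card)) := by
  rw [← sum_cnb G m]
  refine sq_sum_le_card_mul_sum_sq.trans ?_
  apply Nat.mul_le_mul_left
  have h := double_count G m (fun D => (cnb G D).card)
  simp only [← sq] at h
  rw [← h, ← sum_cnb G (m + 1), Finset.mul_sum, mul_comm, ← smul_eq_mul, ← Finset.sum_const,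
    ← Finset.sum_add_distrib]
  apply Finset.sum_le_sum
  intro C hC
  rw [mem_cliqueFinset_iff] at hC
  exact local_bound G m C hC.card_eq

lemma clique_zero_succ {n : ℕ} (G : SimpleGraph (Fin n)) [DecidableRel G.Adj] (m : ℕ)
    (h : (G.cliqueFinset m).card = 0) : (G.cliqueFinset (m + 1)).card = 0 := by
  have := sum_cnb G m
  rw [Finset.card_eq_zero.1 h] at this
  simp only [Finset.sum_empty] at this
  rcases Nat.mul_eq_zero.1 this.symm with h | h
  · omega
  · exact h

lemma clique_one_card {n : ℕ} (G : SimpleGraph (Fin n)) [DecidableRel G.Adj] :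
    (G.cliqueFinset 1).card = n := by
  have h := sum_cnb G 0
  have h0 : G.cliqueFinset 0 = {∅} := by
    ext s
    simp [mem_cliqueFinset_iff, isNClique_zero]
  rw [h0] at h
  simp [cnb] at h
  exact h.symm

/-- target ratio -/
noncomputable def rb (θ : ℝ) (n m : ℕ) : ℝ := (θ - m) / (m + 1) * (n / θ)

lemma step_up {n : ℕ} (G : SimpleGraph (Fin n)) [DecidableRel G.Adj] (θ : ℝ) (hθ : 0 < θ)
    (m : ℕ) (hm : 1 ≤ m)
    (h : rb θ n m * (G.cliqueFinset m).card ≤ (G.cliqueFinset (m + 1)).card) :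
    rb θ n (m + 1) * (G.cliqueFinset (m + 1)).card ≤ (G.cliqueFinset (m + 2)).card := by
  have mm := moon_moser G m
  have hz := clique_zero_succ G m
  generalize (G.cliqueFinset m).card = a at *
  generalize (G.cliqueFinset (m + 1)).card = b at *
  generalize (G.cliqueFinset (m + 2)).card = c at *
  rcases Nat.eq_zero_or_pos a with ha | ha
  · rw [hz ha]; simp
  have mm' : (((m : ℝ) + 1) * b) ^ 2 ≤ a * (n * b + m * ((m + 2) * c)) := by exact_mod_cast mm
  have ha' : (0 : ℝ) < a := by exact_mod_cast ha
  have hm' : (0 : ℝ) < m := by exact_mod_cast hm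
  have hb : (0 : ℝ) ≤ b := by positivity
  have e1 : (m + 1 : ℝ) ^ 2 * rb θ n m - n = m * (m + 2) * rb θ n (m + 1) := by
    unfold rb
    push_cast
    have : (m : ℝ) + 1 + 1 ≠ 0 := by positivity
    field_simp
    ring
  have h2 := mul_le_mul_of_nonneg_left h (by positivity : (0 : ℝ) ≤ (m + 1 : ℝ) ^ 2 * b)
  have h3 : (a * (m * (m + 2)) : ℝ) * (rb θ n (m + 1) * b) ≤ (a * (m * (m + 2))) * c := by
    have : (a * (m * (m + 2)) : ℝ) * (rb θ n (m + 1) * b)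
      = a * b * (m * (m + 2) * rb θ n (m + 1)) := by ring
    rw [this, ← e1]
    nlinarith
  exact le_of_mul_le_mul_left h3 (by positivity)

lemma genChoose_succ (θ : ℝ) (n m : ℕ) :
    genChoose θ (m + 1) * ((n : ℝ) / θ) ^ (m + 1) =
      rb θ n m * (genChoose θ m * ((n : ℝ) / θ) ^ m) := by
  unfold genChoose rb
  rw [Finset.prod_range_succ, Nat.factorial_succ, pow_succ]
  push_cast
  have : (m.factorial : ℝ) ≠ 0 := by positivity
  generalize (n : ℝ) / θ = x
  field_simp

theorem clique_supersaturation (θ : ℝ) (hθ : 0 < θ) (s t : ℕ)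
    (ht : 2 ≤ t) (hts : t ≤ s) (hs : (s : ℝ) ≤ θ + 1)
    (n : ℕ) (G : SimpleGraph (Fin n)) [DecidableRel G.Adj]
    (h : genChoose θ t * ((n : ℝ) / θ) ^ t ≤ ((G.cliqueFinset t).card : ℝ)) :
    genChoose θ s * ((n : ℝ) / θ) ^ s ≤ ((G.cliqueFinset s).card : ℝ) := by
  have hrb : ∀ m : ℕ, m + 1 ≤ s → 0 ≤ rb θ n m := by
    intro m hm
    have : (m : ℝ) + 1 ≤ s := by exact_mod_cast hm
    have h0 : 0 ≤ θ - m := by linarith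
    unfold rb
    positivity
  obtain ⟨r, rfl⟩ : ∃ r, t = r + 1 := ⟨t - 1, by omega⟩
  have hP : rb θ n r * (G.cliqueFinset r).card ≤ (G.cliqueFinset (r + 1)).card := by
    by_contra hneg
    have hlow : ∀ j, 1 ≤ j → j ≤ r →
        ((G.cliqueFinset (j + 1)).card : ℝ) < rb θ n j * (G.cliqueFinset j).card := by
      intro j hj hjr
      by_contra hcon
      rw [not_lt] at hcon
      apply hneg
      clear hneg h
      induction r, hjr using Nat.le_induction with
      | base => exact hcon
      | succ k hk ih => exact step_up G θ hθ k (by omega) (ih (by omega) (by omega))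
    have hle : ∀ j, 1 ≤ j → j ≤ r →
        ((G.cliqueFinset j).card : ℝ) ≤ genChoose θ j * ((n : ℝ) / θ) ^ j := by
      intro j hj
      induction j, hj using Nat.le_induction with
      | base =>
        intro _
        rw [clique_one_card]
        simp [genChoose]
        field_simp
        exact le_refl _
      | succ k hk ih =>
        intro hkr
        rw [genChoose_succ]
        exact (hlow k hk (by omega)).le.trans
          (mul_le_mul_of_nonneg_left (ih (by omega)) (hrb k (by omega)))
    rw [genChoose_succ] at h
    have h1 := hlow r (by omega) le_rfl
    have h2 := mul_le_mul_of_nonneg_left (hle r (by omega) le_rfl) (hrb r (by omega))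
    linarith
  have hup : ∀ j, r ≤ j → rb θ n j * (G.cliqueFinset j).card ≤ (G.cliqueFinset (j + 1)).card := by
    intro j hj
    induction j, hj using Nat.le_induction with
    | base => exact hP
    | succ k hk ih => exact step_up G θ hθ k (by omega) ih
  have key : ∀ j, r + 1 ≤ j → j ≤ s →
      genChoose θ j * ((n : ℝ) / θ) ^ j ≤ ((G.cliqueFinset j).card : ℝ) := by
    intro j hj
    induction j, hj using Nat.le_induction with
    | base => intro _; exact h
    | succ k hk ih =>
      intro hks
      rw [genChoose_succ]
      exact (mul_le_mul_of_nonneg_left (ih (by omega)) (hrb k hks)).trans (hup k (by omega))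
  exact key s hts le_rfl
end

section
/- Let s ≥ 2 be an integer and let c and n satisfy 0 < c < 1/s! and n ≥ exp(c^{−s}). If G is a graph on n vertices with k_s(G) ≥ c·n^s, then G contains, as a subgraph, the blowup K_s(b) with b = ⌊c^s · log n⌋. -/
open SimpleGraph

/-- `G` contains the blowup `K_r(b)` (complete multipartite graph with `r` parts
of size `b`) as a subgraph. -/
def ContainsBlowup {n : ℕ} (G : SimpleGraph (Fin n)) (r b : ℕ) : Prop :=
  ∃ f : (Σ _ : Fin r, Fin b) → Fin n, Function.Injective f ∧
    ∀ a c, (completeMultipartiteGraph fun _ : Fin r => Fin b).Adj a c → G.Adj (f a) (f c)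

open Finset in
/-- Cleaning: a nonempty family of `s`-cliques all of whose shadows have many extensions. -/
lemma nik_clean {n s : ℕ} (hs : 2 ≤ s) (c : ℝ) (hc : 0 < c) (F : Finset (Finset (Fin n)))
    (hn : 0 < n) (hF : ∀ K ∈ F, K.card = s) (hk : c * (n : ℝ) ^ s ≤ (F.card : ℝ)) :
    ∃ M ⊆ F, M.Nonempty ∧ ∀ K ∈ M, ∀ v ∈ K,
      c * n ≤ ((univ.filter fun w => w ∉ K.erase v ∧ insert w (K.erase v) ∈ M).card : ℝ) := by
  classical
  let P : Finset (Finset (Fin n)) → Prop := fun M =>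
    M.Nonempty ∧ c * n * ((M.shadow).card : ℝ) ≤ (M.card : ℝ)
  have hn' : (0 : ℝ) < n := by exact_mod_cast hn
  have hP : P F := by
    constructor
    · rw [← Finset.card_pos]
      have : (0 : ℝ) < F.card := lt_of_lt_of_le (by positivity) hk
      exact_mod_cast this
    · refine le_trans ?_ hk
      have h1 : F.shadow ⊆ powersetCard (s - 1) univ := by
        intro t ht
        rw [mem_shadow_iff] at ht
        obtain ⟨K, hK, a, ha, rfl⟩ := ht
        rw [mem_powersetCard]
        exact ⟨subset_univ _, by rw [card_erase_of_mem ha, hF K hK]⟩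
      have h2 : F.shadow.card ≤ n ^ (s - 1) := by
        refine (card_le_card h1).trans ?_
        rw [card_powersetCard, card_univ, Fintype.card_fin]
        exact Nat.choose_le_pow _ _
      have h3 : (F.shadow.card : ℝ) ≤ (n : ℝ) ^ (s - 1) := by exact_mod_cast h2
      calc c * n * (F.shadow.card : ℝ) ≤ c * n * (n : ℝ) ^ (s - 1) := by gcongr
        _ = c * (n : ℝ) ^ s := by
          rw [mul_assoc, ← pow_succ', Nat.sub_add_cancel (by omega)]
  obtain ⟨M, hM, hmin⟩ := Finset.exists_min_image (F.powerset.filter P) Finset.card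
    ⟨F, by simp [hP]⟩
  rw [mem_filter, mem_powerset] at hM
  obtain ⟨hMF, hMne, hMP⟩ := hM
  refine ⟨M, hMF, hMne, ?_⟩
  intro K hK v hv
  by_contra! hlt
  set Q := K.erase v with hQ
  set R := M.filter (fun K' => Q ⊆ K') with hR
  have hQs : Q ∈ M.shadow := mem_shadow_iff.2 ⟨K, hK, v, hv, rfl⟩
  have hQc : Q.card = s - 1 := by rw [hQ, card_erase_of_mem hv, hF K (hMF hK)]
  have hRc : R.card ≤ (univ.filter fun w => w ∉ Q ∧ insert w Q ∈ M).card := by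
    refine (card_le_card (t := (univ.filter fun w => w ∉ Q ∧ insert w Q ∈ M).image
      (fun w => insert w Q)) ?_).trans card_image_le
    intro K' hK'
    rw [hR, mem_filter] at hK'
    have hc' := hF K' (hMF hK'.1)
    have : (K' \ Q).card = 1 := by rw [card_sdiff_of_subset hK'.2]; omega
    obtain ⟨w, hw⟩ := card_eq_one.1 this
    have hwm : w ∈ K' \ Q := by rw [hw]; simp
    have hins : insert w Q = K' := by
      rw [← sdiff_union_of_subset hK'.2, hw]; rfl
    rw [mem_image]
    refine ⟨w, ?_, hins⟩
    rw [mem_filter]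
    exact ⟨mem_univ _, (mem_sdiff.1 hwm).2, by rw [hins]; exact hK'.1⟩
  have hRc' : (R.card : ℝ) < c * n := lt_of_le_of_lt (by exact_mod_cast hRc) hlt
  have hRM : R ⊆ M := filter_subset _ _
  have hKR : K ∈ R := by rw [hR, mem_filter]; exact ⟨hK, erase_subset _ _⟩
  have hcard : ((M \ R).card : ℝ) = M.card - R.card := by
    rw [card_sdiff_of_subset hRM, Nat.cast_sub (card_le_card hRM)]
  have hsh : (M \ R).shadow ⊆ M.shadow.erase Q := by
    intro t ht
    rw [mem_shadow_iff] at ht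
    obtain ⟨K', hK', a, ha, rfl⟩ := ht
    rw [mem_sdiff] at hK'
    rw [mem_erase]
    refine ⟨?_, mem_shadow_iff.2 ⟨K', hK'.1, a, ha, rfl⟩⟩
    intro he
    apply hK'.2
    rw [hR, mem_filter]
    exact ⟨hK'.1, he ▸ erase_subset _ _⟩
  have hshc : ((M \ R).shadow.card : ℝ) ≤ M.shadow.card - 1 := by
    have h1 := card_le_card hsh
    rw [card_erase_of_mem hQs] at h1
    have h2 : 0 < M.shadow.card := card_pos.2 ⟨Q, hQs⟩
    have : (M \ R).shadow.card + 1 ≤ M.shadow.card := by omega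
    have : ((M \ R).shadow.card : ℝ) + 1 ≤ M.shadow.card := by exact_mod_cast this
    linarith
  have hcn : 0 < c * n := by positivity
  have hf : c * n * ((M \ R).shadow.card : ℝ) < ((M \ R).card : ℝ) := by
    have := mul_le_mul_of_nonneg_left hshc hcn.le
    rw [hcard]
    nlinarith
  have hPM : P (M \ R) := by
    refine ⟨?_, hf.le⟩
    rw [← Finset.card_pos]
    have : (0 : ℝ) < (M \ R).card := lt_of_le_of_lt (by positivity) hf
    exact_mod_cast this
  have := hmin (M \ R) (by
    rw [mem_filter, mem_powerset]
    exact ⟨sdiff_subset.trans hMF, hPM⟩)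
  have h2 : (M \ R).card < M.card := card_lt_card (by
    refine ⟨sdiff_subset, fun h => ?_⟩
    exact (mem_sdiff.1 (h hK)).2 hKR)
  omega

open Finset in
lemma nik_pigeon {n m' m : ℕ} (c : ℝ) (hc : 0 < c) (W : Fin m' → Finset (Fin n))
    (hW : ∀ i, c * n ≤ ((W i).card : ℝ)) (hm : 1 ≤ m) (hm' : ((m : ℝ) - 1) < c / 2 * m')
    (hbig : (m : ℝ) * 2 ^ m' ≤ c / 2 * n) :
    ∃ (eS : Fin m ↪ Fin m') (eT : Fin m ↪ Fin n), ∀ i k, eT k ∈ W (eS i) := by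
  classical
  have hm'0 : (0 : ℝ) < m' := by
    rcases Nat.eq_zero_or_pos m' with h | h
    · subst h
      have : (1 : ℝ) ≤ m := by exact_mod_cast hm
      simp at hm'
      linarith
    · exact_mod_cast h
  let D : Fin n → Finset (Fin m') := fun v => univ.filter fun i => v ∈ W i
  set Good : Finset (Fin n) := univ.filter fun v => c / 2 * m' ≤ ((D v).card : ℝ) with hGood
  have hsum : ∑ v, ((D v).card : ℝ) = ∑ i, ((W i).card : ℝ) := by
    have := Finset.sum_card_bipartiteAbove_eq_sum_card_bipartiteBelow
      (s := (univ : Finset (Fin n))) (t := (univ : Finset (Fin m'))) (fun v i => v ∈ W i)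
    have h2 : ∀ i, (univ.filter fun v => v ∈ W i) = W i := by intro i; ext; simp
    simp only [bipartiteAbove, bipartiteBelow, h2] at this
    exact_mod_cast this
  have hlow : c * n * m' ≤ ∑ v, ((D v).card : ℝ) := by
    rw [hsum]
    calc c * n * m' = ∑ _i : Fin m', c * (n : ℝ) := by simp; ring
      _ ≤ _ := sum_le_sum fun i _ => hW i
  have hup : ∑ v, ((D v).card : ℝ) ≤ Good.card * m' + n * (c / 2 * m') := by
    calc ∑ v, ((D v).card : ℝ)
        ≤ ∑ v, ((if v ∈ Good then (m' : ℝ) else 0) + c / 2 * m') := by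
          refine sum_le_sum fun v _ => ?_
          split_ifs with h
          · have : (D v).card ≤ m' := by simpa using card_le_univ (D v)
            have : ((D v).card : ℝ) ≤ m' := by exact_mod_cast this
            have : 0 < c / 2 * m' := by positivity
            linarith
          · have : ¬ (c / 2 * m' ≤ ((D v).card : ℝ)) := by simpa [hGood] using h
            linarith
      _ = _ := by
          rw [sum_add_distrib]; simp
  have hG : c / 2 * n ≤ (Good.card : ℝ) := by
    have : c / 2 * n * m' ≤ Good.card * m' := by nlinarith
    exact le_of_mul_le_mul_right this hm'0
  have hG2 : (univ : Finset (Finset (Fin m'))).card * m ≤ Good.card := by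
    have : (m : ℝ) * 2 ^ m' ≤ Good.card := hbig.trans hG
    have : m * 2 ^ m' ≤ Good.card := by exact_mod_cast this
    simpa [mul_comm] using this
  obtain ⟨S0, -, hS0⟩ := exists_le_card_fiber_of_mul_le_card_of_maps_to
    (f := D) (s := Good) (t := univ) (fun _ _ => mem_univ _) ⟨∅, mem_univ _⟩ hG2
  have hS0c : m ≤ S0.card := by
    obtain ⟨v, hv⟩ := card_pos.1 (lt_of_lt_of_le hm hS0)
    rw [mem_filter, hGood, mem_filter] at hv
    have h1 := hv.1.2
    rw [hv.2] at h1
    have : (m : ℝ) < S0.card + 1 := by linarith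
    have : m < S0.card + 1 := by exact_mod_cast this
    omega
  obtain ⟨S, hSS, hSc⟩ := exists_subset_card_eq hS0c
  obtain ⟨T, hTT, hTc⟩ := exists_subset_card_eq hS0
  refine ⟨(S.orderEmbOfFin hSc).toEmbedding, (T.orderEmbOfFin hTc).toEmbedding, ?_⟩
  intro i k
  have h1 := hSS (S.orderEmbOfFin_mem hSc i)
  have h2 := hTT (T.orderEmbOfFin_mem hTc k)
  rw [mem_filter] at h2
  rw [← h2.2] at h1
  simpa [D] using h1

lemma nik_fact (s : ℕ) (hs : 1 ≤ s) : 2 ^ (s - 1) ≤ s.factorial := by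
  obtain ⟨k, rfl⟩ := Nat.exists_eq_add_of_le' hs
  rw [Nat.add_sub_cancel]
  induction k with
  | zero => simp
  | succ k ih =>
    rw [Nat.factorial_succ, pow_succ, mul_comm]
    exact Nat.mul_le_mul (by omega) (ih (by omega))

lemma nik_num (s : ℕ) (hs : 2 ≤ s) (c : ℝ) (n : ℕ)
    (hc0 : 0 < c) (hc1 : c < 1 / (s.factorial : ℝ)) (hn : 0 < n)
    (b m m' : ℕ) (hb : 1 ≤ b) (hbn : (b : ℝ) ≤ c ^ s * Real.log n)
    (h1 : ((m' : ℝ) - 1) ≤ (b - 1) * (2 / c) ^ (s - 1))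
    (h2 : ((m : ℝ) - 1) * (2 / c) ≤ (b - 1) * (2 / c) ^ (s - 1)) :
    (m : ℝ) * 2 ^ m' ≤ c / 2 * n := by
  have hn' : (0 : ℝ) < n := by exact_mod_cast hn
  have hb' : (1 : ℝ) ≤ b := by exact_mod_cast hb
  have hf0 : (0 : ℝ) < s.factorial := by exact_mod_cast s.factorial_pos
  have hf : (2 : ℝ) ^ (s - 1) ≤ s.factorial := by exact_mod_cast nik_fact s (by omega)
  have hci : (s.factorial : ℝ) ≤ c⁻¹ := by
    rw [le_inv_comm₀ hf0 hc0, ← one_div]; exact hc1.le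
  have h2c : (2 : ℝ) ≤ c⁻¹ := by
    have : (2 : ℝ) ^ 1 ≤ 2 ^ (s - 1) := pow_le_pow_right₀ (by norm_num) (by omega)
    linarith
  set Z := (2 / c) ^ (s - 1) with hZ
  set W := (c⁻¹) ^ s with hW
  have hZW : Z ≤ W := by
    rw [hZ, hW, div_eq_mul_inv, mul_pow]
    calc (2 : ℝ) ^ (s - 1) * c⁻¹ ^ (s - 1) ≤ c⁻¹ * c⁻¹ ^ (s - 1) := by gcongr; linarith
      _ = c⁻¹ ^ s := by rw [← pow_succ', Nat.sub_add_cancel (by omega)]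
  have hW4 : 4 ≤ W := by
    calc (4 : ℝ) = 2 ^ 2 := by norm_num
      _ ≤ (c⁻¹) ^ 2 := by gcongr
      _ ≤ (c⁻¹) ^ s := pow_le_pow_right₀ (by linarith) hs
  have hZ1 : 2 / c ≤ Z := by
    rw [hZ]
    exact le_self_pow₀ (by rw [div_eq_mul_inv]; linarith) (by omega)
  have hlog : b * W ≤ Real.log n := by
    have : b * W ≤ c ^ s * Real.log n * W := by gcongr
    have e : c ^ s * Real.log n * W = Real.log n := by
      rw [hW, inv_pow, mul_right_comm, mul_inv_cancel₀ (by positivity), one_mul]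
    rwa [e] at this
  set u := b * W with hu
  have hnu : Real.exp u ≤ n := by
    rwa [← Real.le_log_iff_exp_le hn']
  have hu0 : 0 < u := by positivity
  have hl1 := Real.log_two_lt_d9
  have hl2 := Real.log_two_gt_d9
  have hm1 : (m : ℝ) * (2 / c) ≤ u := by
    have : (b : ℝ) * Z ≤ u := by rw [hu]; gcongr
    nlinarith
  have hm2 : (m' : ℝ) ≤ 1 + u - W := by
    have : ((b : ℝ) - 1) * Z ≤ (b - 1) * W :=
      mul_le_mul_of_nonneg_left hZW (by linarith)
    rw [hu]; linarith
  have hpow : (2 : ℝ) ^ m' = Real.exp (m' * Real.log 2) := by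
    rw [mul_comm, Real.exp_mul, Real.exp_log (by norm_num), Real.rpow_natCast]
  have hkey : u * (2 : ℝ) ^ m' ≤ n := by
    refine le_trans ?_ hnu
    have e1 : (m' : ℝ) * Real.log 2 ≤ u * Real.log 2 - 3 * Real.log 2 := by nlinarith
    have e2 : u ≤ Real.exp (u * (1 - Real.log 2) + 3 * Real.log 2) := by
      rw [Real.exp_add]
      have a1 : Real.exp (3 * Real.log 2) = 8 := by
        rw [mul_comm, Real.exp_mul, Real.exp_log (by norm_num)]; norm_num
      have a2 := Real.add_one_le_exp (u * (1 - Real.log 2))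
      rw [a1]
      nlinarith
    rw [hpow]
    calc u * Real.exp (m' * Real.log 2)
        ≤ Real.exp (u * (1 - Real.log 2) + 3 * Real.log 2) *
          Real.exp (u * Real.log 2 - 3 * Real.log 2) := by gcongr
      _ = Real.exp u := by rw [← Real.exp_add]; congr 1; ring
  have : (m : ℝ) * (2 / c) * 2 ^ m' ≤ n := le_trans (by gcongr) hkey
  calc (m : ℝ) * 2 ^ m' = c / 2 * ((m : ℝ) * (2 / c) * 2 ^ m') := by field_simp
    _ ≤ _ := by gcongr

open Finset in
lemma nik_build {n s : ℕ} (hs : 2 ≤ s) (c : ℝ) (hc0 : 0 < c)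
    (hc1 : c < 1 / (s.factorial : ℝ)) (hn : 0 < n) (G : SimpleGraph (Fin n))
    (M : Finset (Finset (Fin n))) (hMne : M.Nonempty) (hM : ∀ K ∈ M, G.IsNClique s K)
    (hext : ∀ K ∈ M, ∀ v ∈ K,
      c * n ≤ ((univ.filter fun w => w ∉ K.erase v ∧ insert w (K.erase v) ∈ M).card : ℝ))
    (b : ℕ) (hb : 1 ≤ b) (hbn : (b : ℝ) ≤ c ^ s * Real.log n) (j : ℕ) (hj : j + 1 ≤ s) :
    ∀ m : ℕ, 1 ≤ m → ((m : ℝ) - 1) * (2 / c) ^ j ≤ (b - 1) * (2 / c) ^ (s - 1) →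
      ∃ g : ℕ → Fin m → Fin n,
        (∀ p < j + 1, Function.Injective (g p)) ∧
        (∀ p < j + 1, ∀ q < j + 1, p ≠ q → ∀ i k, G.Adj (g p i) (g q k)) ∧
        (∀ i, ∃ K ∈ M, ∀ p < j + 1, g p i ∈ K) := by
  classical
  have hb' : (1 : ℝ) ≤ b := by exact_mod_cast hb
  have hf1 : (1 : ℝ) ≤ s.factorial := by exact_mod_cast s.factorial_pos
  have hc2 : c < 1 := lt_of_lt_of_le hc1 (by rw [div_le_one (by linarith)]; exact hf1)
  have hq1 : 1 ≤ 2 / c := by rw [le_div_iff₀ hc0]; linarith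
  induction j with
  | zero =>
    intro m hm hmb
    have hmb' : ((m : ℝ) - 1) ≤ (b - 1) * (2 / c) ^ (s - 1) := by simpa using hmb
    have hnum := nik_num s hs c n hc0 hc1 hn b 1 m hb hbn hmb' (by
      simp only [Nat.cast_one, sub_self, zero_mul]
      exact mul_nonneg (by linarith) (by positivity))
    obtain ⟨K, hK⟩ := hMne
    have hKc : K.card = s := (hM K hK).card_eq
    obtain ⟨v, hv⟩ := card_pos.1 (show 0 < K.card by omega)
    set X := univ.filter fun w => w ∉ K.erase v ∧ insert w (K.erase v) ∈ M with hX
    have hXc : m ≤ X.card := by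
      have h1 := hext K hK v hv
      have h2 : (m : ℝ) < 2 ^ m := by exact_mod_cast Nat.lt_two_pow_self
      have h3 : 0 < c * n := by positivity
      have : (m : ℝ) ≤ X.card := by
        rw [Nat.cast_one, one_mul] at hnum
        linarith
      exact_mod_cast this
    obtain ⟨T, hTX, hTc⟩ := exists_subset_card_eq hXc
    refine ⟨fun _ => T.orderEmbOfFin hTc, fun _ _ => (T.orderEmbOfFin hTc).injective, ?_, ?_⟩
    · intro p hp q hq hpq; omega
    · intro i
      have := hTX (T.orderEmbOfFin_mem hTc i)
      rw [hX, mem_filter] at this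
      exact ⟨_, this.2.2, fun _ _ => mem_insert_self _ _⟩
  | succ j ih =>
    intro m hm hmb
    have hm1 : (1 : ℝ) ≤ m := by exact_mod_cast hm
    set m' := ⌊(2 / c) * ((m : ℝ) - 1)⌋₊ + 1 with hm'
    have hm'le : (m' : ℝ) - 1 ≤ (2 / c) * ((m : ℝ) - 1) := by
      rw [hm']; push_cast
      have := Nat.floor_le (show 0 ≤ (2 / c) * ((m : ℝ) - 1) from
        mul_nonneg (by positivity) (by linarith))
      linarith
    have hm'gt : ((m : ℝ) - 1) < c / 2 * m' := by
      have := Nat.lt_floor_add_one ((2 / c) * ((m : ℝ) - 1))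
      have h2 : (2 / c) * ((m : ℝ) - 1) < m' := by rw [hm']; push_cast; exact this
      calc ((m : ℝ) - 1) = c / 2 * ((2 / c) * ((m : ℝ) - 1)) := by field_simp
        _ < _ := by gcongr
    have hm'b : ((m' : ℝ) - 1) * (2 / c) ^ j ≤ (b - 1) * (2 / c) ^ (s - 1) := by
      refine le_trans ?_ hmb
      calc ((m' : ℝ) - 1) * (2 / c) ^ j ≤ ((2 / c) * ((m : ℝ) - 1)) * (2 / c) ^ j := by gcongr
        _ = _ := by ring
    have hm'1 : 1 ≤ m' := by omega
    have hm'1r : (1 : ℝ) ≤ m' := by exact_mod_cast hm'1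
    obtain ⟨g, ginj, gadj, gK⟩ := ih (by omega) m' hm'1 hm'b
    have hbig := nik_num s hs c n hc0 hc1 hn b m m' hb hbn
      (le_trans (le_mul_of_one_le_right (by linarith) (one_le_pow₀ hq1)) hm'b)
      (le_trans (by
        apply mul_le_mul_of_nonneg_left _ (by linarith)
        exact le_self_pow₀ hq1 (by omega)) hmb)
    have hW : ∀ i, ∃ W : Finset (Fin n), c * n ≤ (W.card : ℝ) ∧ ∀ w ∈ W,
        (∀ p < j + 1, G.Adj (g p i) w) ∧ ∃ K ∈ M, w ∈ K ∧ ∀ p < j + 1, g p i ∈ K := by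
      intro i
      obtain ⟨K, hK, hgK⟩ := gK i
      have hlt : ((range (j + 1)).image fun p => g p i).card < K.card := by
        rw [(hM K hK).card_eq]
        refine lt_of_le_of_lt card_image_le ?_
        rw [card_range]; omega
      obtain ⟨v, hvK, hv⟩ := exists_mem_notMem_of_card_lt_card hlt
      have hin : ∀ p < j + 1, g p i ∈ K.erase v := by
        intro p hp
        rw [mem_erase]
        refine ⟨fun h => hv ?_, hgK p hp⟩
        rw [mem_image]
        exact ⟨p, mem_range.2 hp, h⟩
      refine ⟨_, hext K hK v hvK, ?_⟩
      intro w hw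
      rw [mem_filter] at hw
      obtain ⟨-, hw1, hw2⟩ := hw
      refine ⟨fun p hp => ?_, _, hw2, mem_insert_self _ _, fun p hp =>
        mem_insert_of_mem (hin p hp)⟩
      refine (hM _ hw2).isClique ?_ ?_ ?_
      · exact mem_coe.2 (mem_insert_of_mem (hin p hp))
      · exact mem_coe.2 (mem_insert_self _ _)
      · intro h; exact hw1 (h ▸ hin p hp)
    choose W hWc hWp using hW
    obtain ⟨eS, eT, he⟩ := nik_pigeon c hc0 W hWc hm hm'gt hbig
    refine ⟨fun p i => if p = j + 1 then eT i else g p (eS i), ?_, ?_, ?_⟩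
    · intro p hp
      by_cases h : p = j + 1
      · simpa [h] using eT.injective
      · simp only [h, if_false]
        exact (ginj p (by omega)).comp eS.injective
    · intro p hp q hq hpq i k
      by_cases h : p = j + 1
      · have h' : q ≠ j + 1 := by omega
        simp only [h, h', if_true, if_false]
        exact ((hWp _ _ (he k i)).1 q (by omega)).symm
      · by_cases h' : q = j + 1
        · simp only [h, h', if_true, if_false]
          exact (hWp _ _ (he i k)).1 p (by omega)
        · simp only [h, h', if_false]
          exact gadj p (by omega) q (by omega) hpq _ _
    · intro i
      obtain ⟨K, hK, h1, h2⟩ := (hWp _ _ (he i i)).2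
      refine ⟨K, hK, fun p hp => ?_⟩
      by_cases h : p = j + 1
      · simpa [h] using h1
      · simpa [h] using h2 p (by omega)

/-- Nikiforov's theorem. -/
theorem nikiforov (s : ℕ) (hs : 2 ≤ s) (c : ℝ) (n : ℕ)
    (hc0 : 0 < c) (hc1 : c < 1 / (s.factorial : ℝ))
    (hn : Real.exp ((c ^ s)⁻¹) ≤ (n : ℝ))
    (G : SimpleGraph (Fin n)) [DecidableRel G.Adj]
    (hk : c * (n : ℝ) ^ s ≤ ((G.cliqueFinset s).card : ℝ)) :
    ContainsBlowup G s (⌊c ^ s * Real.log n⌋₊) := by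
  classical
  have hnr : (0 : ℝ) < n := lt_of_lt_of_le (Real.exp_pos _) hn
  have hn0 : 0 < n := by exact_mod_cast hnr
  have hcs : 0 < c ^ s := by positivity
  have hlog : (c ^ s)⁻¹ ≤ Real.log n := (Real.le_log_iff_exp_le hnr).2 hn
  have h1 : 1 ≤ c ^ s * Real.log n := by
    calc 1 = c ^ s * (c ^ s)⁻¹ := (mul_inv_cancel₀ hcs.ne').symm
      _ ≤ _ := by gcongr
  set b := ⌊c ^ s * Real.log n⌋₊ with hbdef
  have hb : 1 ≤ b := (Nat.one_le_floor_iff _).2 h1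
  have hbn : (b : ℝ) ≤ c ^ s * Real.log n := Nat.floor_le (by linarith)
  obtain ⟨M, hMF, hMne, hext⟩ := nik_clean hs c hc0 (G.cliqueFinset s) hn0
    (fun K hK => (SimpleGraph.mem_cliqueFinset_iff.1 hK).card_eq) hk
  obtain ⟨g, ginj, gadj, -⟩ := nik_build hs c hc0 hc1 hn0 G M hMne
    (fun K hK => SimpleGraph.mem_cliqueFinset_iff.1 (hMF hK)) hext b hb hbn (s - 1) (by omega)
    b hb le_rfl
  refine ⟨fun a => g a.1 a.2, ?_, ?_⟩
  · rintro ⟨p, i⟩ ⟨q, k⟩ h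
    simp only at h
    by_cases hpq : p = q
    · subst hpq
      rw [ginj p (by omega) h]
    · exact absurd h (gadj p (by omega) q (by omega) (fun h => hpq (Fin.ext h)) i k).ne
  · rintro ⟨p, i⟩ ⟨q, k⟩ h
    have hpq : p ≠ q := by simpa using h
    exact gadj p (by omega) q (by omega) (fun h => hpq (Fin.ext h)) i k
end

section
/- Let r ≥ 2 and 2 ≤ t ≤ r be integers. For every ε > 0 there exist a constant C = C(ε, r) > 0 and n₀ ∈ ℕ such that for every n ≥ n₀, if G is a graph on n vertices with k_t(G) ≥ (1 + ε)·k_t(T(n,r)), then G contains the blowup K_{r+1}(⌊C·log n⌋) as a subgraph. -/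
open SimpleGraph

namespace ZykovAux

open Finset Filter Topology

section MM
variable {V : Type*} [Fintype V] [DecidableEq V] (G : SimpleGraph V) [DecidableRel G.Adj]

/-- Common neighbours of a set. -/
def cn (B : Finset V) : Finset V := univ.filter fun v => ∀ b ∈ B, G.Adj v b

lemma sum_erase (s : ℕ) (f : Finset V → ℕ) :
    ∑ A ∈ G.cliqueFinset (s+1), ∑ a ∈ A, f (A.erase a)
      = ∑ B ∈ G.cliqueFinset s, (cn G B).card * f B := by
  have h : ∀ B, (cn G B).card * f B = ∑ _v ∈ cn G B, f B := by intro B; simp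
  simp_rw [h]
  rw [Finset.sum_sigma', Finset.sum_sigma']
  refine Finset.sum_bij' (fun x _ => ⟨x.1.erase x.2, x.2⟩) (fun x _ => ⟨insert x.2 x.1, x.2⟩)
    ?_ ?_ ?_ ?_ ?_
  · rintro ⟨A, a⟩ h
    simp only [mem_sigma, mem_cliqueFinset_iff] at h ⊢
    obtain ⟨hA, ha⟩ := h
    refine ⟨?_, ?_⟩
    · have := hA.erase_of_mem ha
      simpa using this
    · simp only [cn, mem_filter, mem_univ, true_and, mem_erase]
      rintro b ⟨hb, hbA⟩
      exact hA.1 ha hbA (Ne.symm hb)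
  · rintro ⟨B, v⟩ h
    simp only [mem_sigma, mem_cliqueFinset_iff, cn, mem_filter, mem_univ, true_and] at h ⊢
    exact ⟨h.1.insert h.2, mem_insert_self _ _⟩
  · rintro ⟨A, a⟩ h
    simp only [mem_sigma] at h
    simp [insert_erase h.2]
  · rintro ⟨B, v⟩ h
    simp only [mem_sigma, mem_cliqueFinset_iff, cn, mem_filter, mem_univ, true_and] at h
    have : v ∉ B := fun hv => G.loopless.irrefl _ (h.2 v hv)
    simp [erase_insert this]
  · rintro ⟨A, a⟩ h
    rfl

lemma sum_cn (s : ℕ) :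
    ∑ B ∈ G.cliqueFinset s, (cn G B).card = (s+1) * (G.cliqueFinset (s+1)).card := by
  have := sum_erase G s (fun _ => 1)
  simp only [mul_one] at this
  rw [← this]
  have : ∀ A ∈ G.cliqueFinset (s+1), ∑ a ∈ A, 1 = s + 1 := by
    intro A hA
    rw [mem_cliqueFinset_iff] at hA
    simp [hA.2]
  rw [Finset.sum_congr rfl this]
  simp [mul_comm]

lemma sum_cn_erase (A : Finset V) (s : ℕ) (hA : A.card = s + 1) :
    ∑ a ∈ A, (cn G (A.erase a)).card ≤ s * (cn G A).card + Fintype.card V := by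
  have h1 : ∑ a ∈ A, (cn G (A.erase a)).card
      = ∑ v : V, (A.filter fun a => v ∈ cn G (A.erase a)).card := by
    have := Finset.sum_card_bipartiteAbove_eq_sum_card_bipartiteBelow (s := A)
      (t := (univ : Finset V)) (fun a v => v ∈ cn G (A.erase a))
    simpa [bipartiteAbove, bipartiteBelow] using this
  have h2 : s * (cn G A).card + Fintype.card V
      = ∑ v : V, ((if v ∈ cn G A then s else 0) + 1) := by
    rw [sum_add_distrib]
    simp [mul_comm]
  rw [h1, h2]
  apply sum_le_sum
  intro v _
  split_ifs with hv
  · exact (card_filter_le _ _).trans hA.le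
  · simp only [cn, mem_filter, mem_univ, true_and, not_forall] at hv
    obtain ⟨b, hb, hvb⟩ := hv
    rw [zero_add]
    refine (card_le_card (t := {b}) ?_).trans (by simp)
    intro a ha
    simp only [cn, mem_filter, mem_univ, true_and, mem_erase] at ha
    rw [mem_singleton]
    by_contra hne
    exact hvb (ha.2 b ⟨fun h => hne h.symm, hb⟩)

lemma moon_moser (s : ℕ) :
    ((s+1) * (G.cliqueFinset (s+1)).card)^2 ≤ (G.cliqueFinset s).card *
      (s * ((s+2) * (G.cliqueFinset (s+2)).card) + Fintype.card V * (G.cliqueFinset (s+1)).card) := by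
  rw [← sum_cn]
  refine sq_sum_le_card_mul_sum_sq.trans (Nat.mul_le_mul_left _ ?_)
  have h := sum_erase G s (fun B => (cn G B).card)
  simp_rw [sq]
  rw [← h]
  calc _ ≤ ∑ A ∈ G.cliqueFinset (s+1), (s * (cn G A).card + Fintype.card V) := by
        apply sum_le_sum
        intro A hA
        rw [mem_cliqueFinset_iff] at hA
        exact sum_cn_erase G A s hA.2
    _ = _ := by
        rw [sum_add_distrib, ← mul_sum, sum_cn]
        simp [mul_comm]

end MM

/-- real clique counts -/
noncomputable def kk {n : ℕ} (G : SimpleGraph (Fin n)) [DecidableRel G.Adj] (s : ℕ) : ℝ :=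
  ((G.cliqueFinset s).card : ℝ)

section
variable {n : ℕ} (G : SimpleGraph (Fin n)) [DecidableRel G.Adj]

lemma kk_nonneg (s : ℕ) : 0 ≤ kk G s := Nat.cast_nonneg _

lemma kk_zero : kk G 0 = 1 := by
  have : G.cliqueFinset 0 = {∅} := by ext; simp [mem_cliqueFinset_iff]
  simp [kk, this]

lemma mm_real (s : ℕ) :
    (((s:ℝ)+1) * kk G (s+1))^2 ≤ kk G s * (s * ((s+2) * kk G (s+2)) + n * kk G (s+1)) := by
  have := moon_moser G s
  rw [Fintype.card_fin] at this
  unfold kk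
  exact_mod_cast this

lemma step (β : ℝ) (s : ℕ) (hs : 1 ≤ s)
    (h : n * kk G s * (1 - s * β) ≤ (s+1) * kk G (s+1)) :
    n * kk G (s+1) * (1 - ((s+1:ℕ):ℝ) * β) ≤ (((s+1:ℕ):ℝ)+1) * kk G (s+2) := by
  have mm := mm_real G s
  have h0 := kk_nonneg G s
  have h1 := kk_nonneg G (s+1)
  have h2 := kk_nonneg G (s+2)
  push_cast
  rcases h0.eq_or_lt with h0 | h0
  · rw [← h0, zero_mul] at mm
    have : kk G (s+1) = 0 := by
      have h3 : ((s:ℝ)+1) * kk G (s+1) = 0 := by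
        have := le_antisymm mm (sq_nonneg _)
        exact pow_eq_zero_iff (two_ne_zero) |>.1 this
      rcases mul_eq_zero.1 h3 with h4 | h4
      · have : (0:ℝ) ≤ s := Nat.cast_nonneg _
        linarith
      · exact h4
    rw [this]
    simp
    positivity
  · have hs' : (0:ℝ) < s := by exact_mod_cast hs
    have e1 : kk G s * (((s:ℝ)+1) * kk G (s+1) * (n * (1 - s*β))) ≤
        kk G s * (s * ((s+2) * kk G (s+2)) + n * kk G (s+1)) := by
      refine le_trans ?_ mm
      have := mul_le_mul_of_nonneg_left h (show 0 ≤ ((s:ℝ)+1) * kk G (s+1) by positivity)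
      nlinarith
    have e2 := le_of_mul_le_mul_left e1 h0
    have e3 : (s:ℝ) * (n * kk G (s+1) * (1 - (s+1) * β)) ≤ s * ((s+1+1) * kk G (s+2)) := by
      nlinarith
    exact le_of_mul_le_mul_left e3 hs'

lemma kk_one_le : ((0:ℕ):ℝ) * 0 + kk G 1 ≤ n := by
  have := sum_cn G 0
  have h2 : (G.cliqueFinset 1).card ≤ n := by
    refine (card_cliqueFinset_le).trans ?_
    simp
  unfold kk
  simp
  exact_mod_cast h2

/-- upper bound -/
lemma upper (β : ℝ) (t : ℕ) (hβ : ∀ s < t, 0 ≤ 1 - s * β)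
    (h : ∀ s, 1 ≤ s → s < t → (s+1) * kk G (s+1) ≤ n * kk G s * (1 - s * β)) :
    (t.factorial : ℝ) * kk G t ≤ n^t * ∏ s ∈ range t, (1 - s * β) := by
  induction t with
  | zero => simp [kk_zero]
  | succ t ih =>
    have ih := ih (fun s hs => hβ s (by omega)) (fun s h1 h2 => h s h1 (by omega))
    have h3 : (t+1) * kk G (t+1) ≤ n * kk G t * (1 - t * β) := by
      rcases Nat.eq_zero_or_pos t with rfl | ht
      · have := kk_one_le G
        simp [kk_zero] at this ⊢
        exact this
      · exact h t ht (by omega)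
    rw [prod_range_succ, Nat.factorial_succ]
    push_cast
    have h4 := hβ t (by omega)
    calc ((t:ℝ)+1) * t.factorial * kk G (t+1) = t.factorial * ((t+1) * kk G (t+1)) := by ring
      _ ≤ t.factorial * (n * kk G t * (1 - t * β)) := by gcongr
      _ = (t.factorial * kk G t) * (n * (1 - t*β)) := by ring
      _ ≤ (n^t * ∏ s ∈ range t, (1 - s * β)) * (n * (1 - t*β)) := by gcongr
      _ = _ := by ring

end

/-- Turán lower bound -/
lemma turan_cn (n r s : ℕ) (hr : 0 < r) (B : Finset (Fin n)) (hB : B.card = s) :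
    (n:ℝ) * (1 - s / r) - s ≤ (cn (turanGraph n r) B).card := by
  have h1 : (univ : Finset (Fin n)) ⊆ cn (turanGraph n r) B ∪
      B.biUnion (fun b => univ.filter fun v : Fin n => (v:ℕ) % r = b % r) := by
    intro v _
    simp only [mem_union, mem_biUnion, cn, mem_filter, mem_univ, true_and, turanGraph_adj]
    by_contra! h
    obtain ⟨⟨b, hb, h1⟩, h2⟩ := h
    exact h2 b hb h1
  have h2 : ∀ b : Fin n, (univ.filter fun v : Fin n => (v:ℕ) % r = b % r).card ≤ n / r + 1 := by
    intro b
    have e : (univ.filter fun v : Fin n => (v:ℕ) % r = b % r).card = n.count (· ≡ b [MOD r]) := by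
      rw [Nat.count_eq_card_filter_range]
      refine card_bij (fun v _ => (v:ℕ)) ?_ ?_ ?_
      · intro v hv
        simp only [mem_filter, mem_univ, true_and, Finset.mem_range] at hv ⊢
        exact ⟨v.2, hv⟩
      · intro v _ w _ h
        exact Fin.ext h
      · intro k hk
        simp only [mem_filter, Finset.mem_range] at hk
        exact ⟨⟨k, hk.1⟩, by simp only [mem_filter, mem_univ, true_and]; exact hk.2, rfl⟩
    rw [e, Nat.count_modEq_card _ hr]
    split_ifs <;> omega
  have h3 : n ≤ (cn (turanGraph n r) B).card + s * (n / r + 1) := by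
    have := card_le_card h1
    rw [card_univ, Fintype.card_fin] at this
    refine this.trans ((card_union_le _ _).trans ?_)
    gcongr
    refine (card_biUnion_le_card_mul _ _ _ (fun b _ => h2 b)).trans ?_
    rw [hB]
  have h4 : (n:ℝ) ≤ (cn (turanGraph n r) B).card + s * ((n / r : ℕ) + 1) := by exact_mod_cast h3
  have h5 : ((n / r : ℕ) : ℝ) ≤ n / r := Nat.cast_div_le
  have h6 : (s:ℝ) * ((n / r : ℕ) + 1) ≤ s * (n / r + 1) := by gcongr
  have : (n:ℝ) * (1 - s / r) - s = n - s * (n / r + 1) := by ring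
  linarith

lemma turan_lower (n r t : ℕ) (hr : 0 < r)
    (h : ∀ s < t, 0 ≤ (n:ℝ) * (1 - s / r) - s) :
    ∏ s ∈ range t, ((n:ℝ) * (1 - s / r) - s) ≤ t.factorial * kk (turanGraph n r) t := by
  induction t with
  | zero => simp [kk_zero]
  | succ t ih =>
    have ih := ih (fun s hs => h s (by omega))
    have h1 : ((n:ℝ) * (1 - t / r) - t) * kk (turanGraph n r) t ≤
        (t+1) * kk (turanGraph n r) (t+1) := by
      have e : ((t:ℝ)+1) * kk (turanGraph n r) (t+1)
          = ∑ B ∈ (turanGraph n r).cliqueFinset t, ((cn (turanGraph n r) B).card : ℝ) := by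
        unfold kk
        exact_mod_cast (sum_cn (turanGraph n r) t).symm
      rw [e]
      have := Finset.card_nsmul_le_sum ((turanGraph n r).cliqueFinset t)
        (fun B => ((cn (turanGraph n r) B).card : ℝ)) ((n:ℝ) * (1 - t / r) - t) (by
          intro B hB
          rw [mem_cliqueFinset_iff] at hB
          exact turan_cn n r t hr B hB.2)
      rw [nsmul_eq_mul, mul_comm] at this
      exact this
    rw [prod_range_succ, Nat.factorial_succ]
    push_cast
    have h4 := h t (by omega)
    calc _ ≤ (t.factorial * kk (turanGraph n r) t) * ((n:ℝ) * (1 - t / r) - t) := by gcongr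
      _ = t.factorial * (((n:ℝ) * (1 - t / r) - t) * kk (turanGraph n r) t) := by ring
      _ ≤ t.factorial * ((t+1) * kk (turanGraph n r) (t+1)) := by gcongr
      _ = _ := by ring

lemma many_cliques (r t : ℕ) (hr : 2 ≤ r) (ht : 2 ≤ t) (htr : t ≤ r)
    (ε : ℝ) (hε : 0 < ε) :
    ∃ c : ℝ, 0 < c ∧ ∀ᶠ n : ℕ in atTop, ∀ (G : SimpleGraph (Fin n)) [DecidableRel G.Adj],
        (1 + ε) * kk (turanGraph n r) t ≤ kk G t → c * n^(r+1) ≤ kk G (r+1) := by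
  have hr0 : (0:ℝ) < r := by positivity
  set p : ℝ := ∏ s ∈ range t, (1 - (s:ℝ) * (1 / r)) with hp
  have hfac : ∀ s < t, 0 < 1 - (s:ℝ) * (1/r) := by
    intro s hs
    have : (s:ℝ) < r := by exact_mod_cast (lt_of_lt_of_le hs htr)
    rw [sub_pos, mul_one_div, div_lt_one hr0]
    exact this
  have hp0 : 0 < p := prod_pos fun s hs => hfac s (by simpa using hs)
  -- choose δ
  have hδ : ∃ δ : ℝ, 0 < δ ∧ ∏ s ∈ range t, (1 - (s:ℝ) * (1 / r - δ)) < (1+ε) * p := by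
    have hc : Continuous fun δ : ℝ => ∏ s ∈ range t, (1 - (s:ℝ) * (1 / r - δ)) := by fun_prop
    have h0 : (fun δ : ℝ => ∏ s ∈ range t, (1 - (s:ℝ) * (1 / r - δ))) 0 < (1+ε) * p := by
      simp only [sub_zero]
      nlinarith
    have h1 := (hc.tendsto 0).eventually (gt_mem_nhds h0)
    have h2 := (h1.filter_mono (nhdsWithin_le_nhds (s := Set.Ioi 0))).and self_mem_nhdsWithin
    obtain ⟨δ, hδ1, hδ2⟩ := h2.exists
    exact ⟨δ, hδ2, hδ1⟩
  obtain ⟨δ, hδ, hδp⟩ := hδ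
  set β : ℝ := 1 / r - δ with hβ
  have hβs : ∀ s : ℕ, s ≤ r → s * δ ≤ 1 - s * β := by
    intro s hs
    have : (s:ℝ) * (1/r) ≤ 1 := by
      rw [mul_one_div, div_le_one hr0]
      exact_mod_cast hs
    rw [hβ]
    nlinarith
  have hβ0 : ∀ s : ℕ, s ≤ r → 0 ≤ 1 - s * β := fun s hs =>
    le_trans (by positivity) (hβs s hs)
  have hpβ : p ≤ ∏ s ∈ range t, (1 - (s:ℝ) * β) := by
    apply Finset.prod_le_prod
    · intro s hs
      exact (hfac s (by simpa using hs)).le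
    · intro s hs
      have : (0:ℝ) ≤ s * δ := by positivity
      rw [hβ]
      nlinarith
  -- asymptotics
  have hlim : Tendsto (fun n : ℕ => (1+ε) * ∏ s ∈ range t, ((1 - (s:ℝ) * (1/r)) - s * (1 / n)))
      atTop (𝓝 ((1+ε) * p)) := by
    apply Tendsto.const_mul
    apply tendsto_finsetProd
    intro s _
    have := (tendsto_one_div_atTop_nhds_zero_nat (𝕜 := ℝ)).const_mul (s:ℝ)
    simpa using this.const_sub (1 - (s:ℝ) * (1/r))
  have hev := hlim.eventually (lt_mem_nhds hδp)
  have hev2 : ∀ᶠ n : ℕ in atTop, ∀ s ∈ range t, 0 ≤ (n:ℝ) * (1 - s / r) - s := by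
    rw [Filter.eventually_all_finset]
    intro s hs
    have h1 := hfac s (by simpa using hs)
    have := (tendsto_natCast_atTop_atTop (R := ℝ)).atTop_mul_const h1
    filter_upwards [this.eventually_ge_atTop (s:ℝ)] with n hn
    rw [mul_one_div] at hn
    linarith
  refine ⟨p / t.factorial * (δ / (r+1))^(r+1-t), by positivity, ?_⟩
  filter_upwards [hev, hev2, eventually_gt_atTop 0] with n hn1 hn2 hn0 G _ hG
  have hn0' : (0:ℝ) < n := by exact_mod_cast hn0
  have hkt : (n:ℝ)^t * ∏ s ∈ range t, (1 - (s:ℝ) * β) < t.factorial * kk G t := by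
    have e1 := turan_lower n r t (by omega) (fun s hs => hn2 s (by simpa using hs))
    calc (n:ℝ)^t * ∏ s ∈ range t, (1 - (s:ℝ) * β)
        < n^t * ((1+ε) * ∏ s ∈ range t, ((1 - (s:ℝ) * (1/r)) - s * (1 / n))) := by gcongr
      _ = (1+ε) * ∏ s ∈ range t, ((n:ℝ) * (1 - s / r) - s) := by
          have : ∀ s ∈ range t, ((n:ℝ) * (1 - s / r) - s)
              = n * ((1 - (s:ℝ) * (1/r)) - s * (1 / n)) := by
            intro s _
            field_simp
          rw [prod_congr rfl this, prod_mul_distrib]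
          simp
          ring
      _ ≤ (1+ε) * (t.factorial * kk (turanGraph n r) t) := by gcongr
      _ = t.factorial * ((1+ε) * kk (turanGraph n r) t) := by ring
      _ ≤ _ := by gcongr
  let P : ℕ → Prop := fun s => n * kk G s * (1 - s * β) ≤ (s+1) * kk G (s+1)
  have hstep : ∀ s, 1 ≤ s → P s → P (s+1) := fun s hs h => step G β s hs h
  have hmono : ∀ s s', 1 ≤ s → s ≤ s' → P s → P s' := by
    intro s s' h1 h2 h3
    induction s', h2 using Nat.le_induction with
    | base => exact h3
    | succ m hm ih => exact hstep m (by omega) ih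
  have hPt : P (t-1) := by
    by_contra hc
    have := upper G β t (fun s hs => hβ0 s (by omega)) (by
      intro s h1 h2
      by_contra h3
      exact hc (hmono s (t-1) h1 (by omega) (not_le.1 h3).le))
    linarith
  have hkt2 : p / t.factorial * (n:ℝ)^t ≤ kk G t := by
    have hf : (0:ℝ) < t.factorial := by positivity
    rw [div_mul_eq_mul_div, div_le_iff₀ hf]
    have : (n:ℝ)^t * p ≤ n^t * ∏ s ∈ range t, (1 - (s:ℝ) * β) := by gcongr
    linarith
  have hup : ∀ j, t + j ≤ r + 1 →
      p / t.factorial * (δ / (r+1))^j * (n:ℝ)^(t+j) ≤ kk G (t+j) := by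
    intro j
    induction j with
    | zero => intro _; simpa using hkt2
    | succ j ih =>
      intro hj
      have ih := ih (by omega)
      have hP : P (t+j) := hmono (t-1) (t+j) (by omega) (by omega) hPt
      have h1 : δ ≤ 1 - ((t+j:ℕ):ℝ) * β := by
        refine le_trans ?_ (hβs (t+j) (by omega))
        have : (1:ℝ) ≤ ((t+j:ℕ):ℝ) := by exact_mod_cast (by omega)
        nlinarith
      have h2 : n * kk G (t+j) * δ ≤ (r+1) * kk G (t+j+1) := by
        have a1 := kk_nonneg G (t+j)
        have a2 := kk_nonneg G (t+j+1)
        calc _ ≤ n * kk G (t+j) * (1 - ((t+j:ℕ):ℝ) * β) := by gcongr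
          _ ≤ (((t+j:ℕ):ℝ)+1) * kk G (t+j+1) := hP
          _ ≤ _ := by
            gcongr
            omega
      have h3 : n * kk G (t+j) * δ / (r+1) ≤ kk G (t+j+1) := by
        rw [div_le_iff₀ (by positivity)]
        linarith
      refine le_trans ?_ h3
      calc p / t.factorial * (δ / (r+1))^(j+1) * (n:ℝ)^(t+(j+1))
          = n * (p / t.factorial * (δ / (r+1))^j * (n:ℝ)^(t+j)) * δ / (r+1) := by
            rw [← add_assoc, pow_succ, pow_succ]; ring
        _ ≤ _ := by gcongr
  have := hup (r+1-t) (by omega)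
  rwa [show t + (r+1-t) = r+1 by omega] at this

end ZykovAux

namespace ZykovAux

open Finset Filter Topology

lemma blowup_of_many (r : ℕ) : ∀ c : ℝ, 0 < c → ∃ C : ℝ, 0 < C ∧ C ≤ 1 ∧ ∀ᶠ n : ℕ in atTop,
    ∀ (G : SimpleGraph (Fin n)) (M : Finset (Fin r → Fin n)),
      (∀ x ∈ M, ∀ i j, i ≠ j → G.Adj (x i) (x j)) → c * n^r ≤ M.card →
      ∃ f : Fin r → Fin ⌊C * Real.log n⌋₊ → Fin n,
        (∀ i, Function.Injective (f i)) ∧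
        (∀ i i' j j', i ≠ i' → G.Adj (f i j) (f i' j')) ∧
        (∀ j, (fun i => f i j) ∈ M) := by
  induction r with
  | zero =>
    intro c hc
    refine ⟨1, one_pos, le_rfl, Eventually.of_forall ?_⟩
    intro n G M _ hM
    refine ⟨fun i => i.elim0, fun i => i.elim0, fun i => i.elim0, fun j => ?_⟩
    have : 0 < M.card := by
      have : (0:ℝ) < M.card := by simp at hM; linarith
      exact_mod_cast this
    obtain ⟨x, hx⟩ := card_pos.1 this
    convert hx
  | succ r ih =>
    intro c hc
    obtain ⟨C, hC, hC1, hev⟩ := ih (c/2) (by positivity)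
    refine ⟨min 1 (c * C / 8), by positivity, min_le_left _ _, ?_⟩
    have hlog : Tendsto (fun n : ℕ => Real.log n) atTop atTop :=
      Real.tendsto_log_atTop.comp tendsto_natCast_atTop_atTop
    have hl2 : Real.log 2 < 1 := by have := Real.log_two_lt_d9; linarith
    have hsmall : ∀ᶠ n : ℕ in atTop, Real.log n ≤ c / 4 * (n:ℝ)^(1 - Real.log 2) := by
      have h1 := isLittleO_log_rpow_atTop (r := 1 - Real.log 2) (by linarith)
      have h2 := (h1.bound (show (0:ℝ) < c/4 by positivity))
      have h3 := (tendsto_natCast_atTop_atTop (R := ℝ)).eventually h2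
      filter_upwards [h3] with n hn
      rw [Real.norm_eq_abs, Real.norm_eq_abs, abs_of_nonneg (a := (n:ℝ)^(1 - Real.log 2))
        (by positivity)] at hn
      exact (le_abs_self _).trans hn
    filter_upwards [hev, hsmall, hlog.eventually_ge_atTop (2 / C), eventually_gt_atTop 0]
      with n hn hns hnl hn0 G M hM hcard
    classical
    have hn0' : (0:ℝ) < n := by exact_mod_cast hn0
    set m := ⌊C * Real.log n⌋₊ with hm
    have hCl : 2 ≤ C * Real.log n := by
      rw [div_le_iff₀ hC] at hnl
      linarith
    have hm1 : C * Real.log n / 2 ≤ m := by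
      have := Nat.lt_floor_add_one (C * Real.log n)
      rw [← hm] at this
      linarith
    have hm2 : (m:ℝ) ≤ C * Real.log n := Nat.floor_le (by linarith)
    have hm0 : (0:ℝ) < m := by linarith
    have hlog0 : 0 < Real.log n := lt_of_lt_of_le (by positivity) hnl
    let d : (Fin r → Fin n) → ℕ := fun y => (univ.filter fun v : Fin n => (Fin.snoc y v : Fin (r+1) → Fin n) ∈ M).card
    have hMd : M.card = ∑ y, d y := by
      have e : M.card = ∑ y, (M.filter fun x => Fin.init x = y).card :=
        card_eq_sum_card_fiberwise (f := fun x : Fin (r+1) → Fin n => (Fin.init x : Fin r → Fin n))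
          (t := univ) (fun _ _ => by simp)
      rw [e]
      refine sum_congr rfl fun y _ => ?_
      refine card_bij' (fun x _ => x (Fin.last r)) (fun v _ => Fin.snoc y v) ?_ ?_ ?_ ?_
      · intro x hx
        simp only [mem_filter, mem_univ, true_and] at hx ⊢
        rw [← hx.2, Fin.snoc_init_self]
        exact hx.1
      · intro v hv
        simp only [mem_filter, mem_univ, true_and] at hv ⊢
        exact ⟨hv, Fin.init_snoc _ _⟩
      · intro x hx
        simp only [mem_filter] at hx
        rw [← hx.2, Fin.snoc_init_self]
      · intro v hv
        simp
    let T : Finset (Fin r → Fin n) := univ.filter fun y => c/2 * n ≤ d y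
    have hdn : ∀ y, (d y : ℝ) ≤ n := by
      intro y
      have : d y ≤ n := (card_le_univ _).trans (by simp)
      exact_mod_cast this
    have hT : c/2 * (n:ℝ)^r ≤ T.card := by
      have h1 : (M.card : ℝ) ≤ T.card * n + n^r * (c/2 * n) := by
        rw [hMd]
        push_cast
        calc ∑ y, (d y : ℝ) ≤ ∑ y : Fin r → Fin n, ((if y ∈ T then (n:ℝ) else 0) + c/2 * n) := by
              apply sum_le_sum
              intro y _
              split_ifs with hy
              · have := hdn y
                have : 0 ≤ c/2 * n := by positivity
                linarith [hdn y]
              · simp only [T, mem_filter, mem_univ, true_and, not_le] at hy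
                linarith
          _ = _ := by
            rw [sum_add_distrib]
            simp
      have h2 : c/2 * (n:ℝ)^r * n ≤ T.card * n := by
        rw [pow_succ] at hcard
        nlinarith
      exact le_of_mul_le_mul_right h2 hn0'
    have hTc : ∀ x ∈ T, ∀ i j, i ≠ j → G.Adj (x i) (x j) := by
      intro x hx i j hij
      simp only [T, mem_filter, mem_univ, true_and] at hx
      have : (0:ℝ) < d x := lt_of_lt_of_le (by positivity) hx
      have : 0 < d x := by exact_mod_cast this
      obtain ⟨v, hv⟩ := card_pos.1 this
      simp only [mem_filter, mem_univ, true_and] at hv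
      have := hM _ hv i.castSucc j.castSucc (by simpa using hij)
      simpa using this
    obtain ⟨f, hf1, hf2, hf3⟩ := hn G T hTc hT
    let S : Fin n → Finset (Fin m) := fun v =>
      univ.filter fun j => (Fin.snoc (fun i => f i j) v : Fin (r+1) → Fin n) ∈ M
    have hS : ∑ v, ((S v).card : ℝ) = ∑ j, (d (fun i => f i j) : ℝ) := by
      have := Finset.sum_card_bipartiteAbove_eq_sum_card_bipartiteBelow (s := (univ : Finset (Fin n)))
        (t := (univ : Finset (Fin m)))
        (fun v j => (Fin.snoc (fun i => f i j) v : Fin (r+1) → Fin n) ∈ M)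
      exact_mod_cast this
    have hS2 : m * (c/2 * n) ≤ ∑ v, ((S v).card : ℝ) := by
      rw [hS]
      have := Finset.card_nsmul_le_sum (univ : Finset (Fin m))
        (fun j => (d (fun i => f i j) : ℝ)) (c/2 * n) (by
          intro j _
          have := hf3 j
          simp only [T, mem_filter, mem_univ, true_and] at this
          exact this)
      simpa using this
    let W : Finset (Fin n) := univ.filter fun v => c/4 * m ≤ (S v).card
    have hW : c/4 * n ≤ W.card := by
      have h1 : ∑ v, ((S v).card : ℝ) ≤ W.card * m + n * (c/4 * m) := by
        calc ∑ v, ((S v).card : ℝ) ≤ ∑ v : Fin n, ((if v ∈ W then (m:ℝ) else 0) + c/4 * m) := by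
              apply sum_le_sum
              intro v _
              split_ifs with hy
              · have h1 : (S v).card ≤ m := (card_le_univ _).trans (by simp)
                have h2 : ((S v).card : ℝ) ≤ m := by exact_mod_cast h1
                have : 0 ≤ c/4 * m := by positivity
                linarith
              · simp only [W, mem_filter, mem_univ, true_and, not_le] at hy
                linarith
          _ = _ := by
            rw [sum_add_distrib]
            simp
      have h2 : c/4 * n * m ≤ W.card * m := by nlinarith
      exact le_of_mul_le_mul_right h2 hm0
    have hWne : W.Nonempty := by
      rw [← card_pos]
      have : (0:ℝ) < W.card := lt_of_lt_of_le (by positivity) hW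
      exact_mod_cast this
    set b := ⌊min 1 (c * C / 8) * Real.log n⌋₊ with hb
    have hbf : (b:ℝ) ≤ min 1 (c * C / 8) * Real.log n := Nat.floor_le (by positivity)
    have hb1 : (b:ℝ) ≤ Real.log n := by
      refine hbf.trans ?_
      have := min_le_left 1 (c * C / 8)
      nlinarith
    have hb2 : (b:ℝ) ≤ c/4 * m := by
      have h1 : (b:ℝ) ≤ c * C / 8 * Real.log n := by
        refine hbf.trans ?_
        have := min_le_right 1 (c * C / 8)
        gcongr
      have h2 : c/4 * (C * Real.log n / 2) ≤ c/4 * m := by gcongr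
      linarith
    -- pigeonhole
    have hpig : ∃ Z ∈ W.image S, b ≤ (W.filter fun v => S v = Z).card := by
      apply exists_le_card_fiber_of_mul_le_card_of_maps_to
        (fun v hv => mem_image_of_mem S hv) (hWne.image S)
      have h1 : (W.image S).card ≤ 2^m := by
        refine (card_le_univ _).trans ?_
        simp
      have h2 : ((2:ℝ)^m) * b ≤ W.card := by
        have h3 : (2:ℝ)^m ≤ (n:ℝ)^(Real.log 2) := by
          rw [← Real.rpow_natCast, Real.rpow_def_of_pos (by norm_num), Real.rpow_def_of_pos hn0',
            Real.exp_le_exp]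
          have : (m:ℝ) ≤ Real.log n := by nlinarith
          have h0 : 0 < Real.log 2 := Real.log_pos (by norm_num)
          nlinarith
        calc ((2:ℝ)^m) * b ≤ (n:ℝ)^(Real.log 2) * (c / 4 * (n:ℝ)^(1 - Real.log 2)) := by
              gcongr
              exact hb1.trans hns
          _ = c/4 * ((n:ℝ)^(Real.log 2) * (n:ℝ)^(1 - Real.log 2)) := by ring
          _ = c/4 * n := by
            rw [← Real.rpow_add hn0']
            simp
          _ ≤ _ := hW
      have h2' : 2^m * b ≤ W.card := by exact_mod_cast h2
      exact (Nat.mul_le_mul_right _ h1).trans h2'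
    obtain ⟨Z, hZ, hbZ⟩ := hpig
    have hbZ2 : b ≤ Z.card := by
      obtain ⟨v, hv, rfl⟩ := mem_image.1 hZ
      simp only [W, mem_filter, mem_univ, true_and] at hv
      have := hb2.trans hv
      exact_mod_cast this
    obtain ⟨A, hA, hAc⟩ := exists_subset_card_eq hbZ
    obtain ⟨Y, hY, hYc⟩ := exists_subset_card_eq hbZ2
    let g := A.orderEmbOfFin hAc
    let e := Y.orderEmbOfFin hYc
    have key : ∀ j j', (Fin.snoc (fun i => f i (e j)) (g j') : Fin (r+1) → Fin n) ∈ M := by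
      intro j j'
      have h1 : g j' ∈ W.filter fun v => S v = Z := hA (A.orderEmbOfFin_mem hAc j')
      have h2 : e j ∈ Z := hY (Y.orderEmbOfFin_mem hYc j)
      rw [← (mem_filter.1 h1).2] at h2
      exact (mem_filter.1 h2).2
    have keyadj : ∀ i j j', G.Adj (f i (e j)) (g j') := by
      intro i j j'
      have := hM _ (key j j') i.castSucc (Fin.last r) (Fin.castSucc_lt_last i).ne
      simpa using this
    refine ⟨fun i j => (Fin.snoc (fun i => f i (e j)) (g j) : Fin (r+1) → Fin n) i, ?_, ?_, ?_⟩
    · intro i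
      induction i using Fin.lastCases with
      | last => intro j j' h; simpa using h
      | cast i =>
        intro j j' h
        simp only [Fin.snoc_castSucc] at h
        exact e.injective (hf1 i h)
    · intro i i' j j' hne
      induction i using Fin.lastCases with
      | last =>
        induction i' using Fin.lastCases with
        | last => exact absurd rfl hne
        | cast i' => simpa using (keyadj i' j' j).symm
      | cast i =>
        induction i' using Fin.lastCases with
        | last => simpa using keyadj i j j'
        | cast i' => simpa using hf2 i i' (e j) (e j') (by simpa using hne)
    · intro j
      exact key j j

end ZykovAux

/-- Structural supersaturation extension of Zykov's result. -/
theorem zykov_structural_supersaturation (r t : ℕ) (hr : 2 ≤ r) (ht : 2 ≤ t) (htr : t ≤ r)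
    (ε : ℝ) (hε : 0 < ε) :
    ∃ C : ℝ, 0 < C ∧ ∃ n₀ : ℕ, ∀ n : ℕ, n₀ ≤ n →
      ∀ (G : SimpleGraph (Fin n)) [DecidableRel G.Adj],
        (1 + ε) * (((turanGraph n r).cliqueFinset t).card : ℝ)
            ≤ ((G.cliqueFinset t).card : ℝ) →
        ContainsBlowup G (r + 1) ⌊C * Real.log n⌋₊ := by
  obtain ⟨c, hc, hev⟩ := ZykovAux.many_cliques r t hr ht htr ε hε
  obtain ⟨C, hC, -, hev2⟩ := ZykovAux.blowup_of_many (r+1) c hc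
  obtain ⟨n₀, hn₀⟩ := Filter.eventually_atTop.1 (hev.and hev2)
  refine ⟨C, hC, n₀, fun n hn G _ hG => ?_⟩
  obtain ⟨h1, h2⟩ := hn₀ n hn
  have h3 := h1 G hG
  classical
  obtain ⟨f, hf1, hf2, -⟩ := h2 G
    (Finset.univ.filter fun x : Fin (r+1) → Fin n => ∀ i j, i ≠ j → G.Adj (x i) (x j))
    (fun x hx => (Finset.mem_filter.1 hx).2) (by
      refine h3.trans ?_
      unfold ZykovAux.kk
      rw [Nat.cast_le]
      refine Finset.card_le_card_of_surjOn (fun x => Finset.univ.image x) ?_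
      intro A hA
      rw [Finset.mem_coe, mem_cliqueFinset_iff] at hA
      refine ⟨A.orderEmbOfFin hA.2, ?_, ?_⟩
      · simp only [Finset.coe_filter, Finset.mem_univ, true_and, Set.mem_ofPred_eq]
        intro i j hij
        exact hA.1 (A.orderEmbOfFin_mem hA.2 i) (A.orderEmbOfFin_mem hA.2 j)
          (fun h => hij ((A.orderEmbOfFin hA.2).injective h))
      · exact Finset.image_orderEmbOfFin_univ A hA.2)
  refine ⟨fun a => f a.1 a.2, ?_, ?_⟩
  · rintro ⟨i, j⟩ ⟨i', j'⟩ h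
    simp only at h
    by_cases hi : i = i'
    · subst hi
      rw [hf1 i h]
    · exact absurd h (hf2 i i' j j' hi).ne
  · rintro ⟨i, j⟩ ⟨i', j'⟩ h
    exact hf2 i i' j j' h
end
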